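/- arXiv:1805.00304 — 2 statements merged into one kernel-verified Lean document; each statement's English description precedes it below -/
import Mathlib

section
/- Let K be a field, σ a finite type of indeterminates, and fix an admissible monomial order ≼ on σ →₀ ℕ. Define a strict order ≺ₚ on MvPolynomial σ K by: p ≺ₚ q iff there exists a monomial v ∈ σ →₀ ℕ with coeff p v = 0, coeff q v ≠ 0, and coeff p u = coeff q u for all monomials u with v ≺ u. Then ≺ₚ is well-founded: every nonempty set Q ⊆ MvPolynomial σ K contains a ≺ₚ-minimal element q, i.e., some q ∈ Q such that no y ∈ Q satisfies y ≺ₚ q. -/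
open MvPolynomial Relation

/-- An admissible monomial order on `σ →₀ ℕ`: a linear order such that `0` is the
smallest element and which is compatible with addition. -/
structure AdmissibleOrder (σ : Type*) where
  le : (σ →₀ ℕ) → (σ →₀ ℕ) → Prop
  total : ∀ s t, le s t ∨ le t s
  refl : ∀ t, le t t
  trans : ∀ s t u, le s t → le t u → le s u
  antisymm : ∀ s t, le s t → le t s → s = t
  zero_le : ∀ t, le 0 t
  add_right : ∀ s t u, le s t → le (s + u) (t + u)

namespace AdmissibleOrder

variable {σ : Type*} {K : Type*} [Field K]

/-- The strict part of an admissible order. -/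
def lt (m : AdmissibleOrder σ) (s t : σ →₀ ℕ) : Prop := m.le s t ∧ s ≠ t

-- The leading monomial of a polynomial: the `m.le`-largest element of its support
-- (`0` for the zero polynomial).
open Classical in
noncomputable def lm (m : AdmissibleOrder σ) (p : MvPolynomial σ K) : σ →₀ ℕ :=
  if h : ∃ v, v ∈ p.support ∧ ∀ u ∈ p.support, m.le u v then h.choose else 0

/-- The leading coefficient of a polynomial. -/
noncomputable def lc (m : AdmissibleOrder σ) (p : MvPolynomial σ K) : K :=
  coeff (m.lm p) p

/-- One-step polynomial reduction modulo a set `F`. -/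
def Red (m : AdmissibleOrder σ) (F : Set (MvPolynomial σ K))
    (p q : MvPolynomial σ K) : Prop :=
  ∃ f ∈ F, f ≠ 0 ∧ ∃ t : σ →₀ ℕ,
    coeff (t + m.lm f) p ≠ 0 ∧
    q = p - (coeff (t + m.lm f) p / m.lc f) • (monomial t (1 : K)) * f

/-- A set `G` is a Gröbner basis iff the reduction relation modulo `G` is confluent. -/
def IsGroebner (m : AdmissibleOrder σ) (G : Set (MvPolynomial σ K)) : Prop :=
  ∀ a b c : MvPolynomial σ K, ReflTransGen (m.Red G) a b → ReflTransGen (m.Red G) a c →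
    ∃ d, ReflTransGen (m.Red G) b d ∧ ReflTransGen (m.Red G) c d

-- The S-polynomial of two polynomials.
open Classical in
noncomputable def spoly (m : AdmissibleOrder σ) (p q : MvPolynomial σ K) :
    MvPolynomial σ K :=
  if p = 0 ∨ q = 0 then 0 else
    (monomial (m.lm p ⊔ m.lm q - m.lm p) (1 / m.lc p)) * p -
    (monomial (m.lm p ⊔ m.lm q - m.lm q) (1 / m.lc q)) * q

end AdmissibleOrder

namespace AdmissibleOrder

variable {σ : Type*}

theorem le_of_le (m : AdmissibleOrder σ) {s t : σ →₀ ℕ} (h : s ≤ t) : m.le s t := by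
  simpa [tsub_add_cancel_of_le h] using m.add_right 0 (t - s) s (m.zero_le _)

/-- Dickson's lemma makes every admissible order on finitely many indeterminates
well-founded. -/
theorem lt_wellFounded [Finite σ] (m : AdmissibleOrder σ) : WellFounded m.lt := by
  have : IsPreorder (σ →₀ ℕ) m.le := { refl := m.refl, trans := m.trans }
  have hwqo : WellQuasiOrdered m.le := fun f => by
    obtain ⟨i, j, hij, h⟩ := wellQuasiOrdered_le f
    exact ⟨i, j, hij, m.le_of_le h⟩
  exact Subrelation.wf (fun h => ⟨h.1, fun h' => h.2 (m.antisymm _ _ h.1 h')⟩)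
    hwqo.wellFounded

theorem trichotomous_swap_lt (m : AdmissibleOrder σ) :
    Std.Trichotomous (Function.swap m.lt) where
  trichotomous s t hst hts := by
    by_contra hne
    exact (m.total s t).elim (fun h => hts ⟨h, hne⟩) (fun h => hst ⟨h, Ne.symm hne⟩)

end AdmissibleOrder

theorem wellFounded_eq_zero_and_ne_zero {M : Type*} [Zero M] :
    WellFounded fun a b : M => a = 0 ∧ b ≠ 0 :=
  have hzero : Acc (fun a b : M => a = 0 ∧ b ≠ 0) 0 := ⟨0, fun _ h => (h.2 rfl).elim⟩
  ⟨fun b => ⟨b, fun _ h => h.1 ▸ hzero⟩⟩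

/-- The order `≺ₚ` on polynomials (where `p ≺ₚ q` iff there is a monomial `v` with
`coeff v p = 0`, `coeff v q ≠ 0`, and `coeff u p = coeff u q` for all `u` with `v ≺ u`)
is well-founded: every nonempty set of polynomials has a `≺ₚ`-minimal element. -/
theorem ord_p_wellFounded {σ K : Type*} [Fintype σ] [Field K] (m : AdmissibleOrder σ)
    (Q : Set (MvPolynomial σ K)) (hQ : Q.Nonempty) :
    ∃ q ∈ Q, ∀ y ∈ Q,
      ¬ ∃ v : σ →₀ ℕ, MvPolynomial.coeff v y = 0 ∧ MvPolynomial.coeff v q ≠ 0 ∧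
        ∀ u : σ →₀ ℕ, m.lt v u → MvPolynomial.coeff u y = MvPolynomial.coeff u q := by
  have := m.trichotomous_swap_lt
  have hlex : WellFounded
      (Finsupp.Lex (Function.swap m.lt) fun a b : K => a = 0 ∧ b ≠ 0) :=
    Finsupp.Lex.wellFounded' (fun _ h => h.2 rfl) wellFounded_eq_zero_and_ne_zero
      m.lt_wellFounded
  obtain ⟨q, hq, hmin⟩ :=
    (InvImage.wf (AddMonoidAlgebra.coeff : MvPolynomial σ K → _) hlex).has_min Q hQ
  exact ⟨q, hq, fun y hy ⟨v, hyv, hqv, huv⟩ => hmin y hy ⟨v, huv, hyv, hqv⟩⟩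
end

section
/- (Macaulay/row-echelon triangularization) Let K be a field, σ a type of indeterminates, and fix an admissible monomial order ≼ on σ →₀ ℕ. Let V be a finite-dimensional K-linear subspace of MvPolynomial σ K (regarded as a K-vector space). Then there exists a finite set H of polynomials such that 0 ∉ H, every h ∈ H is monic (lc h = 1), the leading monomials lp(h) for h ∈ H are pairwise distinct, and the K-linear span of H equals V. -/
open MvPolynomial Relation

namespace AdmissibleOrder

theorem exists_max_of_nonempty {σ : Type*} (m : AdmissibleOrder σ) {s : Finset (σ →₀ ℕ)}
    (hs : s.Nonempty) : ∃ v, v ∈ s ∧ ∀ u ∈ s, m.le u v := by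
  classical
  induction hs using Finset.Nonempty.cons_induction with
  | singleton a => exact ⟨a, by simp, by simp [m.refl]⟩
  | cons a s ha hs ih =>
    obtain ⟨v, hv, hmax⟩ := ih
    rcases m.total a v with h | h
    · refine ⟨v, by simp [hv], fun u hu => ?_⟩
      rcases Finset.mem_cons.1 hu with rfl | hu
      exacts [h, hmax u hu]
    · refine ⟨a, by simp, fun u hu => ?_⟩
      rcases Finset.mem_cons.1 hu with rfl | hu
      exacts [m.refl _, m.trans _ _ _ (hmax u hu) h]

theorem lc_ne_zero {σ K : Type*} [Field K] (m : AdmissibleOrder σ) {p : MvPolynomial σ K}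
    (hp : p ≠ 0) : m.lc p ≠ 0 := by
  have h := m.exists_max_of_nonempty (support_nonempty.2 hp)
  rw [lc, lm, dif_pos h]
  exact mem_support_iff.1 h.choose_spec.1

theorem lm_smul {σ K : Type*} [Field K] (m : AdmissibleOrder σ) {c : K} (hc : c ≠ 0)
    (p : MvPolynomial σ K) : m.lm (c • p) = m.lm p := by
  have h : (c • p).support = p.support := support_smul_eq hc p
  unfold lm
  congr! 1 <;> simp only [h]

theorem lc_inv_lc_smul {σ K : Type*} [Field K] (m : AdmissibleOrder σ) {p : MvPolynomial σ K}
    (hp : p ≠ 0) : m.lc ((m.lc p)⁻¹ • p) = 1 := by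
  have hc := m.lc_ne_zero hp
  rw [lc, m.lm_smul (inv_ne_zero hc), coeff_smul, smul_eq_mul]
  exact inv_mul_cancel₀ hc

theorem ne_zero_of_lc_eq_one {σ K : Type*} [Field K] (m : AdmissibleOrder σ)
    {p : MvPolynomial σ K} (hp : m.lc p = 1) : p ≠ 0 := by
  rintro rfl
  simp [lc] at hp

end AdmissibleOrder

/-- Macaulay/row-echelon triangularization: every finite-dimensional `K`-linear subspace
of the polynomial ring is spanned by a finite set of monic polynomials, none zero, whose
leading monomials are pairwise distinct. -/
theorem macaulay_triangularization {σ K : Type*} [Field K] (m : AdmissibleOrder σ)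
    (V : Submodule K (MvPolynomial σ K)) [FiniteDimensional K V] :
    ∃ H : Set (MvPolynomial σ K), H.Finite ∧ (0 : MvPolynomial σ K) ∉ H ∧
      (∀ h ∈ H, m.lc h = 1) ∧ Set.InjOn m.lm H ∧ Submodule.span K H = V := by
  induction hn : Module.finrank K V using Nat.strong_induction_on generalizing V with
  | _ n ih =>
  by_cases hV : V = ⊥
  · exact ⟨∅, by simp [hV]⟩
  obtain ⟨v, hv, hv0⟩ := V.exists_mem_ne_zero_of_ne_bot hV
  obtain ⟨w, hw, hw1⟩ : ∃ w ∈ V, m.lc w = 1 :=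
    ⟨_, V.smul_mem _ hv, m.lc_inv_lc_smul hv0⟩
  have hw1' : coeff (m.lm w) w = 1 := hw1
  let W := V ⊓ LinearMap.ker (lcoeff K (m.lm w))
  have hmem {p} : p ∈ W ↔ p ∈ V ∧ coeff (m.lm w) p = 0 := Iff.rfl
  have hlt : W < V := inf_le_left.lt_of_ne fun h => by
    have : w ∈ W := h.ge hw
    simp [hmem, hw1'] at this
  have : FiniteDimensional K W := Submodule.finiteDimensional_of_le hlt.le
  obtain ⟨H, hfin, h0, hmonic, hinj, hspan⟩ :=
    ih _ (hn ▸ Submodule.finrank_lt_finrank_of_lt hlt) W rfl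
  have hne : ∀ h ∈ H, m.lm h ≠ m.lm w := fun h hh heq => by
    have hc : coeff (m.lm h) h = 1 := hmonic h hh
    have hz := (hmem.1 (hspan ▸ Submodule.subset_span hh)).2
    rw [heq, hz] at hc
    exact zero_ne_one hc
  have hlc : ∀ h ∈ insert w H, m.lc h = 1 := Set.forall_mem_insert.2 ⟨hw1, hmonic⟩
  refine ⟨insert w H, hfin.insert w, fun h => m.ne_zero_of_lc_eq_one (hlc 0 h) rfl, hlc,
    (Set.injOn_insert fun h => hne w h rfl).2
      ⟨hinj, fun ⟨h, hh, heq⟩ => hne h hh heq⟩, ?_⟩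
  rw [Submodule.span_insert, hspan]
  refine le_antisymm (sup_le ((Submodule.span_singleton_le_iff_mem _ _).2 hw) hlt.le)
    fun p hp => ?_
  rw [Submodule.mem_sup]
  exact ⟨coeff (m.lm w) p • w, Submodule.smul_mem _ _ (Submodule.mem_span_singleton_self w),
    p - coeff (m.lm w) p • w,
    hmem.2 ⟨V.sub_mem hp (V.smul_mem _ hw), by simp [hw1']⟩, by simp⟩
end
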